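/- Let X be a nonempty compact metric space, τ : X → ℝ a 1-Lipschitz function, and u : ℕ → X a sequence with dense range, and let κ = κ_{τ,u} : X → ℝ × ℓ^∞ be the timed-Kuratowski map. Then κ is time preserving, i.e. (κ x).1 = τ x for every x ∈ X, and κ preserves the causal relation encoded by τ: for all p, q ∈ X, one has τ(p) − τ(q) = dist(p, q) if and only if (κ p).1 − (κ q).1 = dist(κ p, κ q). -/

import Mathlib

open Metric ENNReal

/-- The Kuratowski map of a compact metric space into `ℓ^∞`, defined from a sequence of
points: `x ↦ (n ↦ dist (u n) x)`. -/
noncomputable def kuratowskiMap {X : Type*} [MetricSpace X] [CompactSpace X]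
    (u : ℕ → X) (x : X) : lp (fun _ : ℕ => ℝ) ∞ :=
  ⟨fun n => dist (u n) x, memℓp_infty ⟨Metric.diam (Set.univ : Set X), by
    rintro r ⟨n, rfl⟩
    simpa [Real.norm_eq_abs, abs_of_nonneg dist_nonneg] using
      Metric.dist_le_diam_of_mem isCompact_univ.isBounded (Set.mem_univ (u n))
        (Set.mem_univ x)⟩⟩

/-- The timed-Kuratowski map `x ↦ (τ x, (n ↦ dist (u n) x))` into `ℝ × ℓ^∞`,
where the product carries the max product distance. -/
noncomputable def timedKuratowskiMap {X : Type*} [MetricSpace X] [CompactSpace X]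
    (τ : X → ℝ) (u : ℕ → X) (x : X) : ℝ × lp (fun _ : ℕ => ℝ) ∞ :=
  (τ x, kuratowskiMap u x)

theorem kuratowskiMap_isometry {X : Type*} [MetricSpace X] [CompactSpace X]
    {u : ℕ → X} (hu : DenseRange u) : Isometry (kuratowskiMap u) := by
  refine Isometry.of_dist_eq fun p q => le_antisymm ?_ ?_
  · rw [dist_eq_norm]
    refine lp.norm_le_of_forall_le dist_nonneg fun n => ?_
    change |dist (u n) p - dist (u n) q| ≤ dist p q
    simpa only [dist_comm (u n)] using abs_dist_sub_le p q (u n)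
  · have hle : ∀ z, dist q z - dist p z ≤ dist (kuratowskiMap u p) (kuratowskiMap u q) := by
      refine fun z => hu.induction_on z (isClosed_le (by fun_prop) continuous_const) fun n => ?_
      have h := lp.norm_apply_le_norm ENNReal.top_ne_zero
        (kuratowskiMap u p - kuratowskiMap u q) n
      rw [← dist_eq_norm] at h
      change |dist (u n) p - dist (u n) q| ≤ _ at h
      rw [dist_comm q, dist_comm p]
      linarith [neg_abs_le (dist (u n) p - dist (u n) q)]
    simpa [dist_comm q p] using hle p

theorem timedKuratowskiMap_isometry {X : Type*} [MetricSpace X] [CompactSpace X]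
    {τ : X → ℝ} (hτ : LipschitzWith 1 τ) {u : ℕ → X} (hu : DenseRange u) :
    Isometry (timedKuratowskiMap τ u) := by
  refine Isometry.of_dist_eq fun p q => ?_
  change max (dist (τ p) (τ q)) (dist (kuratowskiMap u p) (kuratowskiMap u q)) = _
  rw [(kuratowskiMap_isometry hu).dist_eq]
  exact max_eq_right (by simpa using hτ.dist_le_mul p q)

/-- The timed-Kuratowski map is time preserving and preserves the causal relation
encoded by the time function: `q` causally precedes `p` (i.e. `τ p - τ q = dist p q`)
iff the images satisfy the corresponding relation in `ℝ × ℓ^∞`, where the time function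
on `ℝ × ℓ^∞` is the first coordinate. -/
theorem timedKuratowski_time_and_causal_preserving {X : Type*}
    [MetricSpace X] [CompactSpace X] [Nonempty X]
    (τ : X → ℝ) (hτ : LipschitzWith 1 τ) (u : ℕ → X) (hu : DenseRange u) :
    (∀ x : X, (timedKuratowskiMap τ u x).1 = τ x) ∧
      ∀ p q : X,
        (τ p - τ q = dist p q ↔
          (timedKuratowskiMap τ u p).1 - (timedKuratowskiMap τ u q).1 =
            dist (timedKuratowskiMap τ u p) (timedKuratowskiMap τ u q)) := by
  refine ⟨fun _ => rfl, fun p q => ?_⟩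
  rw [(timedKuratowskiMap_isometry hτ hu).dist_eq]
  rfl
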